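/- Let G=(V,E) be a digraph with E nonempty, positive capacities cap, and α ∈ (0,1) rational. Then every feasible MMCFS solution A for (G,cap,α) (in particular the trivial solution A = E) satisfies |A| ≤ (1 + (1−α)/(2α) · (max_{e∈E} cap(e))/(min_{e∈E} cap(e))) · |O|, where O is any optimal feasible MMCFS solution. -/

import Mathlib

open Finset

variable {V : Type*}

/-- A flow for the commodity `(s,t)` of value `d`, supported on the edge set `E`. -/
def IsFlow [Fintype V] [DecidableEq V] (E : Finset (V × V)) (s t : V) (d : ℚ)
    (f : V × V → ℚ) : Prop :=
  (∀ e, 0 ≤ f e) ∧ (∀ e, e ∉ E → f e = 0) ∧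
    ∀ v : V,
      ((∑ e ∈ E.filter (fun e => e.2 = v), f e) -
          ∑ e ∈ E.filter (fun e => e.1 = v), f e) =
        (if v = t then d else 0) - (if v = s then d else 0)

/-- The traffic matrix `T` is routable in the edge set `A ⊆ E` via a multi-commodity flow. -/
def Routable [Fintype V] [DecidableEq V] (E : Finset (V × V)) (cap : V × V → ℚ)
    (T : V × V → ℚ) (A : Finset (V × V)) : Prop :=
  ∃ f : V × V → V × V → ℚ,
    (∀ p : V × V, IsFlow E p.1 p.2 (T p) (f p)) ∧
    (∀ e ∈ E, (∑ p : V × V, f p e) ≤ cap e) ∧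
    (∀ e ∈ E, e ∉ A → (∑ p : V × V, f p e) = 0)

/-- The traffic matrix `T_E` demanding `cap e` for each edge `e ∈ E` and `0` otherwise. -/
def trafficTE [Fintype V] [DecidableEq V] (E : Finset (V × V)) (cap : V × V → ℚ) :
    V × V → ℚ := fun p => if p ∈ E then cap p else 0

/-- A traffic matrix is a nonnegative function on pairs of vertices. -/
def IsTrafficMatrix (T : V × V → ℚ) : Prop := ∀ p, 0 ≤ T p

/-- `A ⊆ E` is a feasible MMCFS solution: every traffic matrix routable in `E`
remains routable in `A` after scaling by `α`. -/
def MMCFSFeasible [Fintype V] [DecidableEq V] (E : Finset (V × V)) (cap : V × V → ℚ)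
    (α : ℚ) (A : Finset (V × V)) : Prop :=
  A ⊆ E ∧ ∀ T : V × V → ℚ, IsTrafficMatrix T → Routable E cap T E →
    Routable E cap (fun p => α * T p) A

/-- Pairing the conservation law of a flow with a potential `φ` on the vertices. -/
theorem IsFlow.sum_mul_potential [Fintype V] [DecidableEq V] {E : Finset (V × V)} {s t : V}
    {d : ℚ} {f : V × V → ℚ} (hf : IsFlow E s t d f) (φ : V → ℚ) :
    ∑ e ∈ E, f e * (φ e.2 - φ e.1) = d * (φ t - φ s) := by
  have hfib (g : V × V → V) :
      ∑ v, φ v * ∑ e ∈ E.filter (fun e => g e = v), f e = ∑ e ∈ E, f e * φ (g e) := by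
    rw [← Finset.sum_fiberwise E g]
    refine Finset.sum_congr rfl fun v _ => ?_
    rw [Finset.mul_sum]
    refine Finset.sum_congr rfl fun e he => ?_
    rw [(Finset.mem_filter.mp he).2, mul_comm]
  calc ∑ e ∈ E, f e * (φ e.2 - φ e.1)
      = ∑ v, φ v * ((∑ e ∈ E.filter (fun e => e.2 = v), f e) -
          ∑ e ∈ E.filter (fun e => e.1 = v), f e) := by
        simp only [mul_sub, Finset.sum_sub_distrib]
        rw [hfib Prod.snd, hfib Prod.fst]
    _ = ∑ v, φ v * ((if v = t then d else 0) - (if v = s then d else 0)) :=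
        Finset.sum_congr rfl fun v _ => by rw [hf.2.2 v]
    _ = d * (φ t - φ s) := by
        simp [mul_sub, Finset.sum_sub_distrib, mul_comm]

/-- A flow between distinct vertices has total load at least its value. -/
theorem IsFlow.le_sum [Fintype V] [DecidableEq V] {E : Finset (V × V)} {s t : V}
    {d : ℚ} {f : V × V → ℚ} (hf : IsFlow E s t d f) (hst : s ≠ t) :
    d ≤ ∑ e ∈ E, f e := by
  have h := hf.sum_mul_potential (fun v => if v = t then 1 else 0)
  simp only [if_true, if_neg hst, sub_zero, mul_one] at h
  rw [← h]
  refine Finset.sum_le_sum fun e _ => mul_le_of_le_one_right (hf.1 e) ?_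
  split_ifs <;> norm_num

/-- A flow between distinct vertices that avoids the direct edge has total load at least twice
its value. -/
theorem IsFlow.two_mul_le_sum [Fintype V] [DecidableEq V] {E : Finset (V × V)} {s t : V}
    {d : ℚ} {f : V × V → ℚ} (hf : IsFlow E s t d f) (hst : s ≠ t) (h_direct : f (s, t) = 0) :
    2 * d ≤ ∑ e ∈ E, f e := by
  have h := hf.sum_mul_potential (fun v => (if v = t then 1 else 0) - (if v = s then 1 else 0))
  simp only [if_true, if_neg hst, if_neg hst.symm] at h
  have hle : ∑ e ∈ E, f e * (((if e.2 = t then 1 else 0) - (if e.2 = s then 1 else 0)) -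
      ((if e.1 = t then 1 else 0) - (if e.1 = s then 1 else 0))) ≤ ∑ e ∈ E, f e := by
    refine Finset.sum_le_sum fun e _ => ?_
    by_cases he : e = (s, t)
    · simp [he, h_direct]
    · refine mul_le_of_le_one_right (hf.1 e) ?_
      have hne : ¬ (e.1 = s ∧ e.2 = t) := fun h => he (Prod.ext h.1 h.2)
      split_ifs <;> first | (exfalso; tauto) | norm_num
  linarith

/-- Sending `cap e` along each edge `e` routes the traffic matrix `trafficTE`. -/
theorem routable_trafficTE [Fintype V] [DecidableEq V] (E : Finset (V × V)) (cap : V × V → ℚ)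
    (hcap : ∀ e ∈ E, 0 < cap e) : Routable E cap (trafficTE E cap) E := by
  refine ⟨fun p e => if e = p then trafficTE E cap p else 0, fun p => ⟨fun e => ?_, ?_, ?_⟩,
    fun e he => ?_, fun e he hne => absurd he hne⟩
  · by_cases hp : p ∈ E
    · have := (hcap p hp).le
      simp only [trafficTE, if_pos hp]
      split_ifs <;> simp [this]
    · simp [trafficTE, hp]
  · intro e he
    dsimp only
    split_ifs with hep
    · subst hep
      simp [trafficTE, he]
    · rfl
  · intro v
    by_cases hp : p ∈ E
    · simp [hp, eq_comm]
    · simp [trafficTE, hp]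
  · simp [trafficTE, he]

/-- The capacity outside a feasible solution is bounded by the capacity inside it. -/
theorem MMCFSFeasible.two_mul_sum_sdiff_le [Fintype V] [DecidableEq V] {E : Finset (V × V)}
    (hE : ∀ e ∈ E, e.1 ≠ e.2) {cap : V × V → ℚ} (hcap : ∀ e ∈ E, 0 < cap e)
    {α : ℚ} {A : Finset (V × V)} (hA : MMCFSFeasible E cap α A) :
    2 * α * ∑ e ∈ E \ A, cap e ≤ (1 - α) * ∑ e ∈ A, cap e := by
  obtain ⟨hAE, hroute⟩ := hA
  have hT : IsTrafficMatrix (trafficTE E cap) := fun p => by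
    unfold trafficTE
    split_ifs with hp
    exacts [(hcap p hp).le, le_rfl]
  obtain ⟨f, hflow, hle, hzero⟩ := hroute _ hT (routable_trafficTE E cap hcap)
  have hin : ∑ p ∈ A, α * cap p ≤ ∑ p ∈ A, ∑ e ∈ E, f p e :=
    Finset.sum_le_sum fun p hp => by
      simpa [trafficTE, hAE hp] using (hflow p).le_sum (hE p (hAE hp))
  have hout : ∑ p ∈ E \ A, 2 * (α * cap p) ≤ ∑ p ∈ E \ A, ∑ e ∈ E, f p e :=
    Finset.sum_le_sum fun p hp => by
      obtain ⟨hpE, hpA⟩ := Finset.mem_sdiff.mp hp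
      have h_direct : f p p = 0 :=
        (Finset.sum_eq_zero_iff_of_nonneg fun q _ => (hflow q).1 p).mp (hzero p hpE hpA) p
          (Finset.mem_univ p)
      simpa [trafficTE, hpE] using (hflow p).two_mul_le_sum (hE p hpE) h_direct
  have hload : ∑ p ∈ E, ∑ e ∈ E, f p e ≤ ∑ e ∈ A, cap e :=
    calc ∑ p ∈ E, ∑ e ∈ E, f p e
        ≤ ∑ p, ∑ e ∈ E, f p e :=
          Finset.sum_le_univ_sum_of_nonneg fun p => Finset.sum_nonneg fun e _ => (hflow p).1 e
      _ = ∑ e ∈ E, ∑ p, f p e := Finset.sum_comm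
      _ = ∑ e ∈ A, ∑ p, f p e := (Finset.sum_subset hAE hzero).symm
      _ ≤ ∑ e ∈ A, cap e := Finset.sum_le_sum fun e he => hle e (hAE he)
  have hsplit := Finset.sum_sdiff (f := fun p => ∑ e ∈ E, f p e) hAE
  simp only [← Finset.mul_sum] at hin hout
  linarith

theorem stmt4 [Fintype V] [DecidableEq V] (E : Finset (V × V)) (hne : E.Nonempty)
    (hE : ∀ e ∈ E, e.1 ≠ e.2) (cap : V × V → ℚ) (hcap : ∀ e ∈ E, 0 < cap e)
    (α : ℚ) (h0 : 0 < α) (h1 : α < 1) (O A : Finset (V × V))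
    (hOfeas : MMCFSFeasible E cap α O)
    (hOopt : ∀ B : Finset (V × V), MMCFSFeasible E cap α B → O.card ≤ B.card)
    (hAfeas : MMCFSFeasible E cap α A) :
    (A.card : ℚ) ≤
      (1 + (1 - α) / (2 * α) * (E.sup' hne cap / E.inf' hne cap)) * O.card := by
  have hmin : 0 < E.inf' hne cap := (Finset.lt_inf'_iff hne).mpr hcap
  have hout : ((E \ O).card : ℚ) * E.inf' hne cap ≤ ∑ e ∈ E \ O, cap e := by
    rw [← nsmul_eq_mul]
    exact Finset.card_nsmul_le_sum _ _ _ fun e he =>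
      Finset.inf'_le cap (Finset.mem_sdiff.mp he).1
  have hin : ∑ e ∈ O, cap e ≤ (O.card : ℚ) * E.sup' hne cap := by
    rw [← nsmul_eq_mul]
    exact Finset.sum_le_card_nsmul _ _ _ fun e he => Finset.le_sup' cap (hOfeas.1 he)
  have hbound : ((E \ O).card : ℚ) * (2 * α * E.inf' hne cap) ≤
      (1 - α) * E.sup' hne cap * O.card := by
    have hout' := mul_le_mul_of_nonneg_left hout (by positivity : 0 ≤ 2 * α)
    have hin' := mul_le_mul_of_nonneg_left hin (sub_nonneg.mpr h1.le)
    linarith [hOfeas.two_mul_sum_sdiff_le hE hcap]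
  have hsdiff : ((E \ O).card : ℚ) ≤
      (1 - α) / (2 * α) * (E.sup' hne cap / E.inf' hne cap) * O.card := by
    rw [div_mul_div_comm, div_mul_eq_mul_div, le_div_iff₀ (by positivity)]
    exact hbound
  have hAE : (A.card : ℚ) ≤ E.card := by exact_mod_cast Finset.card_le_card hAfeas.1
  have hcard : ((E \ O).card : ℚ) + O.card = E.card := by
    exact_mod_cast Finset.card_sdiff_add_card_eq_card hOfeas.1
  linarith
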